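/- arXiv:2406.05428 — 7 statements merged into one kernel-verified Lean document; each statement's English description precedes it below -/
import Mathlib

section
/- (KL divergence bound for correlated Bernoulli pairs; Lemma C.2, first part.) For all p ∈ (0,1/2] and ρ ∈ (0,1), the Kullback–Leibler divergence between Bern(p,p,ρ) and the product Bern(p)⊗Bern(p) satisfies D(Bern(p,p,ρ) ‖ Bern(p)⊗Bern(p)) ≤ 25·p²·φ(γ). Explicitly, with p₁₁ = p² + ρp(1−p), p₁₀ = p₀₁ = (1−ρ)p(1−p), p₀₀ = (1−p)² + ρp(1−p): p₁₁·log(p₁₁/p²) + 2·p₁₀·log(p₁₀/(p(1−p))) + p₀₀·log(p₀₀/(1−p)²) ≤ 25·p²·((1+γ)·log(1+γ) − γ), where γ = ρ(1−p)/p. -/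
open MeasureTheory

namespace KLBern

/-- The Bernoulli(p) measure on `Bool`. -/
noncomputable def bern (p : ℝ) : Measure Bool :=
  ENNReal.ofReal p • Measure.dirac true + ENNReal.ofReal (1 - p) • Measure.dirac false

/-- The correlated Bernoulli pair distribution `Bern(p,p,ρ)` on `Bool × Bool`. -/
noncomputable def bernPair (p ρ : ℝ) : Measure (Bool × Bool) :=
  ENNReal.ofReal (p ^ 2 + ρ * p * (1 - p)) • Measure.dirac (true, true)
    + ENNReal.ofReal ((1 - ρ) * p * (1 - p)) • Measure.dirac (true, false)
    + ENNReal.ofReal ((1 - ρ) * p * (1 - p)) • Measure.dirac (false, true)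
    + ENNReal.ofReal ((1 - p) ^ 2 + ρ * p * (1 - p)) • Measure.dirac (false, false)

/-- Kullback–Leibler divergence between two measures on a finite type. -/
noncomputable def klFin {α : Type*} [Fintype α] [MeasurableSpace α] (μ ν : Measure α) : ℝ :=
  ∑ x : α, (μ {x}).toReal * Real.log ((μ {x}).toReal / (ν {x}).toReal)

/-- Explicit form of the divergence between `Bern(p,p,ρ)` and the product of its marginals. -/
lemma klFin_bernPair_prod {p ρ : ℝ} (hp : 0 ≤ p) (hp1 : p ≤ 1) (hρ : 0 ≤ ρ) (hρ1 : ρ ≤ 1) :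
    klFin (bernPair p ρ) ((bern p).prod (bern p)) =
      (p ^ 2 + ρ * p * (1 - p)) * Real.log ((p ^ 2 + ρ * p * (1 - p)) / p ^ 2)
        + 2 * ((1 - ρ) * p * (1 - p)) * Real.log (((1 - ρ) * p * (1 - p)) / (p * (1 - p)))
        + ((1 - p) ^ 2 + ρ * p * (1 - p)) *
            Real.log (((1 - p) ^ 2 + ρ * p * (1 - p)) / (1 - p) ^ 2) := by
  have hq : 0 ≤ 1 - p := by linarith
  have hr : 0 ≤ 1 - ρ := by linarith
  have h11 : 0 ≤ p ^ 2 + ρ * p * (1 - p) := by positivity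
  have h10 : 0 ≤ (1 - ρ) * p * (1 - p) := by positivity
  have h00 : 0 ≤ (1 - p) ^ 2 + ρ * p * (1 - p) := by positivity
  have : SFinite (bern p) := by unfold bern; infer_instance
  have hprod (a b : Bool) :
      ((bern p).prod (bern p)) {(a, b)} = bern p {a} * bern p {b} := by
    rw [← Set.singleton_prod_singleton, Measure.prod_prod]
  have ht : bern p {true} = ENNReal.ofReal p := by simp [bern]
  have hf : bern p {false} = ENNReal.ofReal (1 - p) := by simp [bern]
  simp only [klFin, Fintype.sum_prod_type, Fintype.sum_bool, hprod, ht, hf, ENNReal.toReal_mul,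
    ENNReal.toReal_ofReal hp, ENNReal.toReal_ofReal hq]
  simp [bernPair, ENNReal.toReal_ofReal, h11, h10, h00]
  rw [mul_comm (1 - p) p]
  ring_nf

/-- Rational lower bound for `φ(x) = (1 + x) log (1 + x) - x`. -/
lemma sq_div_le_one_add_mul_log_sub {x : ℝ} (hx : 0 ≤ x) :
    x ^ 2 / (x + 2) ≤ (1 + x) * Real.log (1 + x) - x := by
  have h := mul_le_mul_of_nonneg_left (Real.le_log_one_add_of_nonneg hx)
    (by linarith : 0 ≤ 1 + x)
  have e : x ^ 2 / (x + 2) = (1 + x) * (2 * x / (x + 2)) - x := by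
    field_simp
    ring
  linarith

/-- **Lemma C.2, first part**: KL divergence bound for correlated Bernoulli pairs,
`D(Bern(p,p,ρ) ‖ Bern(p)⊗Bern(p)) ≤ 25·p²·φ(γ)`, together with its explicit form. -/
theorem kl_bern_pair_le (p ρ : ℝ) (hp : 0 < p) (hp2 : p ≤ 1 / 2) (hρ : 0 < ρ) (hρ1 : ρ < 1) :
    klFin (bernPair p ρ) ((bern p).prod (bern p)) ≤
      25 * p ^ 2 *
        ((1 + ρ * (1 - p) / p) * Real.log (1 + ρ * (1 - p) / p) - ρ * (1 - p) / p) ∧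
    (p ^ 2 + ρ * p * (1 - p)) * Real.log ((p ^ 2 + ρ * p * (1 - p)) / p ^ 2)
        + 2 * ((1 - ρ) * p * (1 - p)) * Real.log (((1 - ρ) * p * (1 - p)) / (p * (1 - p)))
        + ((1 - p) ^ 2 + ρ * p * (1 - p)) *
            Real.log (((1 - p) ^ 2 + ρ * p * (1 - p)) / (1 - p) ^ 2) ≤
      25 * p ^ 2 *
        ((1 + ρ * (1 - p) / p) * Real.log (1 + ρ * (1 - p) / p) - ρ * (1 - p) / p) := by
  have hq : 0 < 1 - p := by linarith
  have hr : 0 < 1 - ρ := by linarith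
  rw [klFin_bernPair_prod hp.le (by linarith) hρ.le hρ1.le, and_self]
  set γ := ρ * (1 - p) / p with hγ
  have hγ0 : 0 < γ := by positivity
  have hpγ : p * γ = ρ * (1 - p) := by rw [hγ]; field_simp
  have e11 : p ^ 2 + ρ * p * (1 - p) = p ^ 2 * (1 + γ) := by linear_combination -p * hpγ
  have e10 : (1 - ρ) * p * (1 - p) / (p * (1 - p)) = 1 - ρ := by field_simp
  have e00 : ((1 - p) ^ 2 + ρ * p * (1 - p)) / (1 - p) ^ 2 = 1 + ρ * p / (1 - p) := by
    field_simp
  rw [e11, e10, e00, mul_div_cancel_left₀ _ (by positivity)]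
  have h10 : 2 * ((1 - ρ) * p * (1 - p)) * Real.log (1 - ρ) ≤
      2 * ((1 - ρ) * p * (1 - p)) * (-ρ) := by
    gcongr
    linarith [Real.log_le_sub_one_of_pos hr]
  have h00 : ((1 - p) ^ 2 + ρ * p * (1 - p)) * Real.log (1 + ρ * p / (1 - p)) ≤
      ρ * p * (1 - p) + ρ ^ 2 * p ^ 2 := by
    calc
      _ ≤ ((1 - p) ^ 2 + ρ * p * (1 - p)) * (ρ * p / (1 - p)) := by
        gcongr
        linarith [Real.log_le_sub_one_of_pos (by positivity : 0 < 1 + ρ * p / (1 - p))]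
      _ = _ := by field_simp
  have hφ : 2 * ρ ^ 2 * p * (1 - p) + ρ ^ 2 * p ^ 2 ≤
      24 * p ^ 2 * ((1 + γ) * Real.log (1 + γ) - γ) := by
    calc
      _ ≤ 24 * p ^ 2 * (γ ^ 2 / (γ + 2)) := by
        have e : 24 * p ^ 2 * (γ ^ 2 / (γ + 2)) = 24 * (ρ * (1 - p)) ^ 2 / (γ + 2) := by
          rw [← hpγ]; ring
        rw [e, le_div_iff₀ (by positivity)]
        have h : (2 * (1 - p) + p) * (ρ * (1 - p) + 2 * p) ≤ 24 * (1 - p) ^ 2 := by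
          nlinarith [mul_pos hr hq]
        calc
          _ = ρ ^ 2 * ((2 * (1 - p) + p) * (ρ * (1 - p) + 2 * p)) := by
            rw [← hpγ]; ring
          _ ≤ ρ ^ 2 * (24 * (1 - p) ^ 2) := by gcongr
          _ = _ := by ring
      _ ≤ _ := by
        gcongr
        exact sq_div_le_one_add_mul_log_sub hγ0.le
  linear_combination h10 + h00 + hφ + p * hpγ

end KLBern
end

section
/- (Lemma C.1.) Let γ > 0 and 0 < η ≤ γ/(4(1+γ)), and set φ(x) := (1+x)·log(1+x) − x for x > −1. Then (1+γ)(1−η) > 1 and φ((1−η)(1+γ) − 1) ≥ (1/4)·φ(γ). -/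
/-- `φ(x) = (1+x)·log(1+x) − x`. -/
noncomputable def phi (x : ℝ) : ℝ := (1 + x) * Real.log (1 + x) - x

/-- The graph of `φ` lies above its tangent lines. -/
lemma phi_tangent_le {x y : ℝ} (hx : -1 < x) (hy : -1 < y) :
    phi x + (y - x) * Real.log (1 + x) ≤ phi y := by
  have hx' : 0 < 1 + x := by linarith
  have hy' : 0 < 1 + y := by linarith
  have h := Real.one_sub_inv_le_log_of_pos (div_pos hy' hx')
  rw [Real.log_div hy'.ne' hx'.ne', inv_div] at h
  have h' := mul_le_mul_of_nonneg_left h hy'.le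
  rw [mul_sub, mul_div_cancel₀ _ hy'.ne'] at h'
  unfold phi
  linarith

lemma mul_log_one_add_le_three_mul_phi {x : ℝ} (hx : 0 ≤ x) :
    x * Real.log (1 + x) ≤ 3 * phi x := by
  have h := Real.le_log_one_add_of_nonneg hx
  rw [div_le_iff₀ (by positivity)] at h
  have hlog : 0 ≤ Real.log (1 + x) := Real.log_nonneg (by linarith)
  unfold phi
  nlinarith [mul_nonneg hx hlog]

/-- **Lemma C.1**: for `γ > 0` and `0 < η ≤ γ/(4(1+γ))`, one has `(1+γ)(1−η) > 1` and
`φ((1−η)(1+γ) − 1) ≥ (1/4)·φ(γ)`. -/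
theorem phi_eta_bound (γ η : ℝ) (hγ : 0 < γ) (hη : 0 < η)
    (hηγ : η ≤ γ / (4 * (1 + γ))) :
    1 < (1 + γ) * (1 - η) ∧ (1 / 4) * phi γ ≤ phi ((1 - η) * (1 + γ) - 1) := by
  have hη' : η * (1 + γ) ≤ γ / 4 := by
    rw [le_div_iff₀ (by positivity)] at hηγ
    linarith
  have hgt : 1 < (1 + γ) * (1 - η) := by nlinarith
  refine ⟨hgt, ?_⟩
  have htangent := phi_tangent_le (x := γ) (y := (1 - η) * (1 + γ) - 1)
    (by linarith) (by linarith)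
  have hlog : 0 ≤ Real.log (1 + γ) := Real.log_nonneg (by linarith)
  have hmul : η * (1 + γ) * Real.log (1 + γ) ≤ γ / 4 * Real.log (1 + γ) :=
    mul_le_mul_of_nonneg_right hη' hlog
  have hphi := mul_log_one_add_le_three_mul_phi hγ.le
  linarith
end

section
/- (Lemma C.4.) For every integer m ≥ 10, Σ_{k=1}^{m−1} exp(−m·h(k/m)) ≤ (4·log m + 2)/m, where h(x) = −x·log x − (1−x)·log(1−x) is the binary entropy function (natural logarithm). -/
/-- The binary entropy function `h(x) = −x·log x − (1−x)·log(1−x)` (natural logarithm). -/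
noncomputable def binEnt (x : ℝ) : ℝ := -x * Real.log x - (1 - x) * Real.log (1 - x)

/-- The exponentiated entropy at `k / m` is the binomial monomial of degree `m` at that point. -/
theorem exp_neg_mul_binEnt_div {m k : ℕ} (hk : 1 ≤ k) (hkm : k < m) :
    Real.exp (-(m : ℝ) * binEnt ((k : ℝ) / m)) =
      ((k : ℝ) / m) ^ k * (1 - (k : ℝ) / m) ^ (m - k) := by
  have hm0 : (0 : ℝ) < m := by exact_mod_cast (by omega : 0 < m)
  have hk0 : (0 : ℝ) < k := by exact_mod_cast hk
  have hkm' : (k : ℝ) < m := by exact_mod_cast hkm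
  have hp : 0 < (k : ℝ) / m := by positivity
  have hq : 0 < 1 - (k : ℝ) / m := by
    rw [sub_pos, div_lt_one hm0]
    exact hkm'
  rw [← Real.exp_log (mul_pos (pow_pos hp k) (pow_pos hq (m - k))),
    Real.log_mul (pow_pos hp k).ne' (pow_pos hq _).ne', Real.log_pow, Real.log_pow,
    Nat.cast_sub hkm.le, binEnt]
  congr 1
  generalize Real.log ((k : ℝ) / m) = x
  generalize Real.log (1 - (k : ℝ) / m) = y
  field_simp
  ring

theorem exp_neg_mul_binEnt_div_le_inv_choose {m k : ℕ} (hk : 1 ≤ k) (hkm : k < m) :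
    Real.exp (-(m : ℝ) * binEnt ((k : ℝ) / m)) ≤ 1 / (m.choose k : ℝ) := by
  have hm0 : (0 : ℝ) < m := by exact_mod_cast (by omega : 0 < m)
  have hp : 0 ≤ (k : ℝ) / m := by positivity
  have hq : 0 ≤ 1 - (k : ℝ) / m := by
    rw [sub_nonneg, div_le_one hm0]
    exact_mod_cast hkm.le
  have hc : (0 : ℝ) < m.choose k := by exact_mod_cast Nat.choose_pos hkm.le
  rw [exp_neg_mul_binEnt_div hk hkm, le_div_iff₀ hc]
  calc _ ≤ ∑ i ∈ Finset.range (m + 1),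
        ((k : ℝ) / m) ^ i * (1 - (k : ℝ) / m) ^ (m - i) * (m.choose i : ℝ) :=
        Finset.single_le_sum
          (f := fun i ↦ ((k : ℝ) / m) ^ i * (1 - (k : ℝ) / m) ^ (m - i) * (m.choose i : ℝ))
          (fun i _ ↦ by positivity) (Finset.mem_range.2 (by omega))
    _ = 1 := by rw [← add_pow, add_sub_cancel, one_pow]

theorem le_choose_of_pos_of_lt {m k : ℕ} (hk : 1 ≤ k) (hkm : k < m) : m ≤ m.choose k := by
  induction m generalizing k with
  | zero => omega
  | succ n ih =>
    obtain ⟨j, rfl⟩ := Nat.exists_eq_add_of_le' hk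
    rcases Nat.lt_or_ge (j + 1) n with h | h
    · have h₁ := ih (by omega) h
      have h₂ : 0 < n.choose j := Nat.choose_pos (by omega)
      rw [Nat.choose_succ_succ']
      omega
    · obtain rfl : n = j + 1 := by omega
      simp

theorem choose_two_le_choose {m k : ℕ} (hk : 2 ≤ k) (hkm : k + 2 ≤ m) :
    m.choose 2 ≤ m.choose k := by
  induction m generalizing k with
  | zero => omega
  | succ n ih =>
    obtain ⟨j, rfl⟩ := Nat.exists_eq_add_of_le' hk
    rcases Nat.lt_or_ge (j + 3) n with h | h
    · have h₁ := ih (k := j + 2) (by omega) (by omega)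
      have h₂ := le_choose_of_pos_of_lt (m := n) (k := j + 1) (by omega) (by omega)
      rw [Nat.choose_succ_succ n (j + 1), Nat.choose_succ_succ n 1, Nat.choose_one_right]
      exact Nat.add_le_add h₂ h₁
    · obtain rfl : n = j + 3 := by omega
      exact (Nat.choose_symm_of_eq_add (by omega)).le

theorem inv_choose_le {m k : ℕ} (hk : 1 ≤ k) (hkm : k < m) :
    1 / (m.choose k : ℝ) ≤ 2 / (m * (m - 1)) +
      ((if k = 1 then 1 / (m : ℝ) else 0) + if k = m - 1 then 1 / (m : ℝ) else 0) := by
  have hm1 : (1 : ℝ) < m := by exact_mod_cast (by omega : 1 < m)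
  have hpos : 0 < (m : ℝ) * (m - 1) := mul_pos (by linarith) (by linarith)
  have hm0 : 0 < 1 / (m : ℝ) := by positivity
  have hc := div_pos two_pos hpos
  by_cases h : k = 1 ∨ k = m - 1
  · have h₁ : 1 / (m.choose k : ℝ) ≤ 1 / m :=
      one_div_le_one_div_of_le (by linarith) (by exact_mod_cast le_choose_of_pos_of_lt hk hkm)
    split_ifs <;> first | linarith | omega
  · push Not at h
    have h₁ : ((m.choose 2 : ℕ) : ℝ) ≤ m.choose k := by
      exact_mod_cast choose_two_le_choose (m := m) (k := k) (by omega) (by omega)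
    rw [Nat.cast_choose_two] at h₁
    rw [if_neg h.1, if_neg h.2, add_zero, add_zero, ← one_div_div (_ * _)]
    exact one_div_le_one_div_of_le (by positivity) h₁

/-- **Lemma C.4**: for every integer `m ≥ 10`,
`Σ_{k=1}^{m−1} exp(−m·h(k/m)) ≤ (4·log m + 2)/m`. -/
theorem sum_exp_entropy_bound (m : ℕ) (hm : 10 ≤ m) :
    ∑ k ∈ Finset.Icc 1 (m - 1), Real.exp (-(m : ℝ) * binEnt ((k : ℝ) / m)) ≤
      (4 * Real.log m + 2) / m := by
  have hm' : (10 : ℝ) ≤ m := by exact_mod_cast hm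
  have hlog : 1 ≤ Real.log m := by
    rw [Real.le_log_iff_exp_le (by linarith)]
    linarith [Real.exp_one_lt_d9]
  calc _ ≤ ∑ k ∈ Finset.Icc 1 (m - 1), (2 / ((m : ℝ) * (m - 1)) +
        ((if k = 1 then 1 / (m : ℝ) else 0) + if k = m - 1 then 1 / (m : ℝ) else 0)) := by
        refine Finset.sum_le_sum fun k hk ↦ ?_
        obtain ⟨h₁, h₂⟩ := Finset.mem_Icc.1 hk
        have h₃ : k < m := by omega
        exact (exp_neg_mul_binEnt_div_le_inv_choose h₁ h₃).trans (inv_choose_le h₁ h₃)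
    _ = 4 / m := by
        have hne : (m : ℝ) - 1 ≠ 0 := by linarith
        rw [Finset.sum_add_distrib, Finset.sum_add_distrib, Finset.sum_ite_eq',
          Finset.sum_ite_eq', if_pos (Finset.mem_Icc.2 (by omega)),
          if_pos (Finset.mem_Icc.2 (by omega)), Finset.sum_const, Nat.card_Icc,
          Nat.add_sub_cancel, nsmul_eq_mul, Nat.cast_sub (by omega), Nat.cast_one]
        field_simp
        norm_num
    _ ≤ _ := by
        gcongr
        linarith
end

section
/- (Volume/packing counting inequality; equation (42) in the proof of Lemma 4.1.) For all integers 1 ≤ k ≤ m ≤ n, the strict inequality ( C(n,k) / C(m,k) )² · k! > ( n²·k / (e³·m²) )^k holds, where C(a,b) denotes the binomial coefficient and e is Euler's number. -/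
/-- The ratio of falling factorials dominates the ratio of powers. -/
theorem pow_mul_descFactorial_le {m n : ℕ} (hmn : m ≤ n) (k : ℕ) :
    n ^ k * m.descFactorial k ≤ m ^ k * n.descFactorial k := by
  induction k with
  | zero => simp
  | succ k ih =>
    have h : n * (m - k) ≤ m * (n - k) := by
      rw [Nat.mul_sub, Nat.mul_sub, mul_comm n m]
      exact Nat.sub_le_sub_left (Nat.mul_le_mul_right k hmn) _
    rw [Nat.descFactorial_succ, Nat.descFactorial_succ]
    calc n ^ (k + 1) * ((m - k) * m.descFactorial k)
        = (n * (m - k)) * (n ^ k * m.descFactorial k) := by ring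
      _ ≤ (m * (n - k)) * (m ^ k * n.descFactorial k) := Nat.mul_le_mul h ih
      _ = m ^ (k + 1) * ((n - k) * n.descFactorial k) := by ring

/-- The ratio of binomial coefficients dominates the ratio of powers. -/
theorem pow_mul_choose_le {m n : ℕ} (hmn : m ≤ n) (k : ℕ) :
    n ^ k * m.choose k ≤ m ^ k * n.choose k := by
  have h := pow_mul_descFactorial_le hmn k
  rw [Nat.descFactorial_eq_factorial_mul_choose, Nat.descFactorial_eq_factorial_mul_choose,
    mul_left_comm, mul_left_comm (m ^ k)] at h
  exact Nat.le_of_mul_le_mul_left h k.factorial_pos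

/-- A weak form of Stirling's lower bound for the factorial. -/
theorem div_exp_one_cube_pow_lt_factorial {k : ℕ} (hk : 1 ≤ k) :
    ((k : ℝ) / Real.exp 1 ^ 3) ^ k < (Nat.factorial k : ℝ) := by
  have hk0 : (0 : ℝ) < k := by exact_mod_cast hk
  have hfac : (0 : ℝ) < Nat.factorial k := by exact_mod_cast k.factorial_pos
  have h := Real.pow_div_factorial_le_exp (k : ℝ) hk0.le k
  rw [div_le_iff₀ hfac, ← Real.exp_one_pow] at h
  have hlt : Real.exp 1 < Real.exp 1 ^ 3 :=
    lt_self_pow₀ (Real.one_lt_exp_iff.mpr one_pos) (by norm_num)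
  rw [div_pow, div_lt_iff₀ (by positivity), mul_comm]
  exact h.trans_lt
    (mul_lt_mul_of_pos_right (pow_lt_pow_left₀ hlt (Real.exp_pos 1).le (by lia)) hfac)

/-- **Equation (42)** in the proof of Lemma 4.1 (volume/packing counting inequality):
for `1 ≤ k ≤ m ≤ n`, `(C(n,k)/C(m,k))²·k! > (n²·k/(e³·m²))^k`. -/
theorem counting_inequality (n m k : ℕ) (hk : 1 ≤ k) (hkm : k ≤ m) (hmn : m ≤ n) :
    ((n : ℝ) ^ 2 * k / (Real.exp 1 ^ 3 * (m : ℝ) ^ 2)) ^ k <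
      ((n.choose k : ℝ) / (m.choose k : ℝ)) ^ 2 * (Nat.factorial k : ℝ) := by
  have hm : (0 : ℝ) < m := by exact_mod_cast hk.trans hkm
  have hn : (0 : ℝ) < n := by exact_mod_cast (hk.trans hkm).trans hmn
  have hc : (0 : ℝ) < m.choose k := by exact_mod_cast Nat.choose_pos hkm
  have hratio : ((n : ℝ) / m) ^ k ≤ (n.choose k : ℝ) / m.choose k := by
    rw [div_pow, div_le_div_iff₀ (by positivity) hc, mul_comm (n.choose k : ℝ)]
    exact_mod_cast pow_mul_choose_le hmn k
  calc ((n : ℝ) ^ 2 * k / (Real.exp 1 ^ 3 * (m : ℝ) ^ 2)) ^ k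
      = (((n : ℝ) / m) ^ k) ^ 2 * ((k : ℝ) / Real.exp 1 ^ 3) ^ k := by
        rw [← pow_mul, mul_comm k 2, pow_mul, ← mul_pow, div_pow (n : ℝ), div_mul_div_comm,
          mul_comm ((m : ℝ) ^ 2)]
    _ < (((n : ℝ) / m) ^ k) ^ 2 * (Nat.factorial k : ℝ) :=
        mul_lt_mul_of_pos_left (div_exp_one_cube_pow_lt_factorial hk) (by positivity)
    _ ≤ ((n.choose k : ℝ) / (m.choose k : ℝ)) ^ 2 * (Nat.factorial k : ℝ) := by gcongr
end

section
/- (Lemma 2.1, Erdős–Rényi case, in moment generating function form.) Fix p ∈ (0,1), ρ ∈ (0,1), and t > 0. For an integer ℓ ≥ 1, define m_ℓ := E[ exp( t·Σ_{i=1}^{ℓ} A_{i−1}·B_i ) ] where ((A_i,B_i))_{i=0}^{ℓ} are i.i.d. Bern(p,p,ρ), and m̃_ℓ := E[ exp( t·Σ_{i ∈ ℤ/ℓℤ} A_i·B_{i+1} ) ] where ((A_i,B_i))_{i ∈ ℤ/ℓℤ} are i.i.d. Bern(p,p,ρ). Then: (i) m₁² ≤ m̃₂ ≤ m̃₁²;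 (ii) for every ℓ ≥ 1, m_ℓ ≤ m̃_ℓ; (iii) for every ℓ ≥ 2, m̃_ℓ² ≤ m̃₂^ℓ. (Equivalently, with κ_ℓ^P = log m_ℓ and κ_ℓ^C = log m̃_ℓ: κ₁^P ≤ (1/2)κ₂^C ≤ κ₁^C and κ_ℓ^P ≤ κ_ℓ^C ≤ (ℓ/2)κ₂^C for ℓ ≥ 2.) -/
open MeasureTheory ProbabilityTheory

namespace ERMGF

/-- The correlated Bernoulli pair distribution `Bern(p,p,ρ)` as a measure on `ℝ × ℝ`
supported on `{0,1}²`. -/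
noncomputable def bernPairR (p ρ : ℝ) : Measure (ℝ × ℝ) :=
  ENNReal.ofReal (p ^ 2 + ρ * p * (1 - p)) • Measure.dirac ((1 : ℝ), (1 : ℝ))
    + ENNReal.ofReal ((1 - ρ) * p * (1 - p)) • Measure.dirac ((1 : ℝ), (0 : ℝ))
    + ENNReal.ofReal ((1 - ρ) * p * (1 - p)) • Measure.dirac ((0 : ℝ), (1 : ℝ))
    + ENNReal.ofReal ((1 - p) ^ 2 + ρ * p * (1 - p)) • Measure.dirac ((0 : ℝ), (0 : ℝ))

/-- The path moment generating function
`m_ℓ = E[exp(t·Σ_{i=1}^{ℓ} A_{i−1}·B_i)]` for `ℓ+1` i.i.d. pairs `(A_i,B_i) ~ Bern(p,p,ρ)`. -/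
noncomputable def pathMGF (p ρ t : ℝ) (ℓ : ℕ) : ℝ :=
  ∫ ω : Fin (ℓ + 1) → ℝ × ℝ,
    Real.exp (t * ∑ i : Fin ℓ, (ω i.castSucc).1 * (ω i.succ).2)
    ∂(Measure.pi fun _ => bernPairR p ρ)

/-- The cycle moment generating function
`m̃_ℓ = E[exp(t·Σ_{i ∈ ℤ/ℓℤ} A_i·B_{i+1})]` for `ℓ` i.i.d. pairs `(A_i,B_i) ~ Bern(p,p,ρ)`. -/
noncomputable def cycleMGF (p ρ t : ℝ) (ℓ : ℕ) : ℝ :=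
  ∫ ω : Fin ℓ → ℝ × ℝ,
    Real.exp (t * ∑ i : Fin ℓ, (ω i).1 * (ω (finRotate ℓ i)).2)
    ∂(Measure.pi fun _ => bernPairR p ρ)

/-- The mass function of `Bern(p,p,ρ)`, as a symmetric matrix indexed by `{0,1}`. -/
noncomputable def massMatrix (p ρ : ℝ) : Matrix (Fin 2) (Fin 2) ℝ :=
  !![(1 - p) ^ 2 + ρ * p * (1 - p), (1 - ρ) * p * (1 - p);
     (1 - ρ) * p * (1 - p), p ^ 2 + ρ * p * (1 - p)]

/-- The interaction matrix `K a b = exp (t a b)`. -/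
noncomputable def interaction (t : ℝ) : Matrix (Fin 2) (Fin 2) ℝ :=
  !![1, 1; 1, Real.exp t]

/-- The inclusion of `{0,1}²` in `ℝ × ℝ`. -/
def bitPair (x : Fin 2 × Fin 2) : ℝ × ℝ := (((x.1 : ℕ) : ℝ), ((x.2 : ℕ) : ℝ))

/-- `Bern(p,p,ρ)` as a measure on the finite type `{0,1}²`. -/
noncomputable def bernPairFin (p ρ : ℝ) : Measure (Fin 2 × Fin 2) :=
  ∑ x, ENNReal.ofReal (massMatrix p ρ x.1 x.2) • Measure.dirac x

instance (p ρ : ℝ) : IsFiniteMeasure (bernPairFin p ρ) := by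
  refine ⟨?_⟩
  simp only [bernPairFin, Measure.finsetSum_apply, Measure.smul_apply, smul_eq_mul, measure_univ,
    mul_one]
  exact ENNReal.sum_lt_top.2 fun _ _ => ENNReal.ofReal_lt_top

lemma massMatrix_nonneg {p ρ : ℝ} (hp : 0 ≤ p) (hp1 : p ≤ 1) (hρ : 0 ≤ ρ) (hρ1 : ρ ≤ 1)
    (a b : Fin 2) : 0 ≤ massMatrix p ρ a b := by
  have h1 : 0 ≤ 1 - p := by linarith
  have h2 : 0 ≤ 1 - ρ := by linarith
  fin_cases a <;> fin_cases b <;> simp [massMatrix] <;> positivity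

lemma map_bitPair_bernPairFin (p ρ : ℝ) :
    (bernPairFin p ρ).map bitPair = bernPairR p ρ := by
  have hm : Measurable bitPair := measurable_of_finite _
  simp only [bernPairFin, bernPairR, Fintype.sum_prod_type, Fin.sum_univ_two,
    Measure.map_add _ _ hm, Measure.map_smul, Measure.map_dirac' hm]
  simp only [massMatrix, bitPair, Matrix.of_apply, Matrix.cons_val_zero, Matrix.cons_val_one,
    Fin.val_zero, Fin.val_one, Nat.cast_zero, Nat.cast_one]
  abel

lemma bernPairFin_real_singleton {p ρ : ℝ} (hp : 0 ≤ p) (hp1 : p ≤ 1) (hρ : 0 ≤ ρ)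
    (hρ1 : ρ ≤ 1) (x : Fin 2 × Fin 2) :
    (bernPairFin p ρ).real {x} = massMatrix p ρ x.1 x.2 := by
  classical
  have h : bernPairFin p ρ {x} = ENNReal.ofReal (massMatrix p ρ x.1 x.2) := by
    simp only [bernPairFin, Measure.finsetSum_apply, Measure.smul_apply, smul_eq_mul]
    rw [Finset.sum_eq_single x]
    · simp
    · intro b _ hb
      simp [hb]
    · simp
  rw [measureReal_def, h, ENNReal.toReal_ofReal (massMatrix_nonneg hp hp1 hρ hρ1 _ _)]

lemma integral_pi_bernPairR {p ρ : ℝ} (hp : 0 ≤ p) (hp1 : p ≤ 1) (hρ : 0 ≤ ρ)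
    (hρ1 : ρ ≤ 1) {n : ℕ} (f : (Fin n → ℝ × ℝ) → ℝ) (hf : Measurable f) :
    ∫ ω, f ω ∂(Measure.pi fun _ => bernPairR p ρ) =
      ∑ s : Fin n → Fin 2 × Fin 2,
        (∏ i, massMatrix p ρ (s i).1 (s i).2) * f fun i => bitPair (s i) := by
  have hm : Measurable bitPair := measurable_of_finite _
  rw [← map_bitPair_bernPairFin, ← Measure.pi_map_pi (fun _ => hm.aemeasurable),
    integral_map (measurable_of_finite _).aemeasurable hf.aestronglyMeasurable,
    integral_fintype Integrable.of_finite]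
  refine Finset.sum_congr rfl fun s _ => ?_
  rw [measureReal_def, Measure.pi_singleton, ENNReal.toReal_prod, smul_eq_mul]
  congr 1
  exact Finset.prod_congr rfl fun i _ => bernPairFin_real_singleton hp hp1 hρ hρ1 _

/-- Sums over paths of products of matrix entries are entries of matrix powers. -/
lemma sum_path_eq {S : Type*} [Fintype S] [DecidableEq S] (M : Matrix S S ℝ) (n : ℕ)
    (G : S → S → ℝ) :
    ∑ s : Fin (n + 1) → S, G (s 0) (s (Fin.last n)) * ∏ i : Fin n, M (s i.castSucc) (s i.succ) =
      ∑ x, ∑ y, G x y * (M ^ n) x y := by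
  induction n generalizing G with
  | zero =>
    rw [← (Equiv.funUnique (Fin 1) S).symm.sum_comp]
    simp [Matrix.one_apply]
  | succ n ih =>
    rw [← (Fin.consEquiv fun _ => S).sum_comp, Fintype.sum_prod_type]
    refine Finset.sum_congr rfl fun x _ => ?_
    simp only [Fin.consEquiv_apply, Fin.cons_zero, Fin.prod_univ_succ, Fin.castSucc_zero,
      Fin.cons_succ, ← Fin.succ_castSucc, ← Fin.succ_last]
    have := ih fun a b => G x b * M x a
    simp only [mul_assoc] at this ⊢
    rw [this, Finset.sum_comm]
    refine Finset.sum_congr rfl fun y _ => ?_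
    rw [pow_succ', Matrix.mul_apply, Finset.mul_sum]

/-- Interaction with the next site, indexed by a pair and a bit. -/
noncomputable def emit (t : ℝ) : Matrix (Fin 2 × Fin 2) (Fin 2) ℝ :=
  Matrix.of fun x b => interaction t x.1 b

/-- The mass of a pair, restricted to a given value of its second bit. -/
noncomputable def absorb (p ρ : ℝ) : Matrix (Fin 2) (Fin 2 × Fin 2) ℝ :=
  Matrix.of fun b y => if y.2 = b then massMatrix p ρ y.1 y.2 else 0

lemma emit_mul_absorb (p ρ t : ℝ) (x y : Fin 2 × Fin 2) :
    (emit t * absorb p ρ) x y = interaction t x.1 y.2 * massMatrix p ρ y.1 y.2 := by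
  simp [Matrix.mul_apply, emit, absorb]

lemma absorb_mul_emit (p ρ t : ℝ) :
    absorb p ρ * emit t = massMatrix p ρ * interaction t := by
  ext a b
  fin_cases a <;> fin_cases b <;>
    simp [Matrix.mul_apply, emit, absorb, Fintype.sum_prod_type, Fin.sum_univ_two, massMatrix]

lemma exp_mul_bitPair (t : ℝ) (x y : Fin 2 × Fin 2) :
    Real.exp (t * ((bitPair x).1 * (bitPair y).2)) = interaction t x.1 y.2 := by
  obtain ⟨a, b⟩ := x
  obtain ⟨c, d⟩ := y
  fin_cases a <;> fin_cases d <;> simp [bitPair, interaction]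

lemma pow_succ_mul_comm {m n : Type*} [Fintype m] [Fintype n] [DecidableEq m] [DecidableEq n]
    (U : Matrix m n ℝ) (V : Matrix n m ℝ) (k : ℕ) :
    (U * V) ^ (k + 1) = U * (V * U) ^ k * V := by
  induction k with
  | zero => simp
  | succ k ih => rw [pow_succ, ih, pow_succ]; simp only [Matrix.mul_assoc]

lemma cycleMGF_eq_trace {p ρ : ℝ} (t : ℝ) (hp : 0 ≤ p) (hp1 : p ≤ 1) (hρ : 0 ≤ ρ)
    (hρ1 : ρ ≤ 1) (n : ℕ) :
    cycleMGF p ρ t (n + 1) = ((massMatrix p ρ * interaction t) ^ (n + 1)).trace := by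
  have hmeas : Measurable fun ω : Fin (n + 1) → ℝ × ℝ =>
      Real.exp (t * ∑ i, (ω i).1 * (ω (finRotate (n + 1) i)).2) := by fun_prop
  have htr : ((massMatrix p ρ * interaction t) ^ (n + 1)).trace =
      ((emit t * absorb p ρ) ^ (n + 1)).trace := by
    rw [pow_succ_mul_comm (emit t), Matrix.trace_mul_comm, ← Matrix.mul_assoc, ← pow_succ',
      absorb_mul_emit]
  rw [cycleMGF, integral_pi_bernPairR hp hp1 hρ hρ1 _ hmeas, htr, pow_succ, Matrix.trace]
  simp only [Matrix.diag_apply, Matrix.mul_apply (M := (emit t * absorb p ρ) ^ n)]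
  have h := sum_path_eq (emit t * absorb p ρ) n fun x y => (emit t * absorb p ρ) y x
  simp only [mul_comm ((emit t * absorb p ρ) _ _)] at h
  simp only [mul_comm (((emit t * absorb p ρ) ^ n) _ _)] at h ⊢
  rw [← h]
  refine Finset.sum_congr rfl fun s _ => ?_
  rw [Finset.mul_sum, Real.exp_sum]
  simp only [exp_mul_bitPair, emit_mul_absorb]
  have hrot : ∀ i : Fin n, finRotate (n + 1) i.castSucc = i.succ := fun i => by
    rw [finRotate_apply, Fin.coeSucc_eq_succ]
  rw [Finset.prod_mul_distrib,
    Fin.prod_univ_succ fun i => massMatrix p ρ (s i).1 (s i).2,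
    Fin.prod_univ_castSucc fun i => interaction t (s i).1 (s (finRotate (n + 1) i)).2]
  simp only [hrot, finRotate_last]
  ring

lemma pathMGF_eq_dotProduct {p ρ : ℝ} (t : ℝ) (hp : 0 ≤ p) (hp1 : p ≤ 1) (hρ : 0 ≤ ρ)
    (hρ1 : ρ ≤ 1) (n : ℕ) :
    pathMGF p ρ t (n + 1) = ![1 - p, p] ⬝ᵥ
      ((interaction t * (massMatrix p ρ * interaction t) ^ n).mulVec ![1 - p, p]) := by
  have hmeas : Measurable fun ω : Fin (n + 1 + 1) → ℝ × ℝ =>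
      Real.exp (t * ∑ i : Fin (n + 1), (ω i.castSucc).1 * (ω i.succ).2) := by fun_prop
  have h := sum_path_eq (emit t * absorb p ρ) (n + 1) fun x _ => massMatrix p ρ x.1 x.2
  rw [pow_succ_mul_comm, absorb_mul_emit] at h
  rw [pathMGF, integral_pi_bernPairR hp hp1 hρ hρ1 _ hmeas]
  trans ∑ s : Fin (n + 1 + 1) → Fin 2 × Fin 2, massMatrix p ρ (s 0).1 (s 0).2 *
      ∏ i : Fin (n + 1), (emit t * absorb p ρ) (s i.castSucc) (s i.succ)
  · refine Finset.sum_congr rfl fun s _ => ?_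
    rw [Finset.mul_sum, Real.exp_sum]
    simp only [exp_mul_bitPair, emit_mul_absorb]
    rw [Finset.prod_mul_distrib, Fin.prod_univ_succ (n := n + 1)]
    ring
  · rw [h]
    generalize (massMatrix p ρ * interaction t) ^ n = N
    simp only [Matrix.mul_apply, dotProduct, Matrix.mulVec, Fintype.sum_prod_type,
      Fin.sum_univ_two, emit, absorb, massMatrix, interaction, Matrix.of_apply]
    simp
    ring

lemma massMatrix_eq (p ρ : ℝ) :
    massMatrix p ρ = Matrix.vecMulVec ![1 - p, p] (star ![1 - p, p]) +
      (ρ * p * (1 - p)) • Matrix.vecMulVec ![-1, 1] (star ![-1, 1]) := by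
  ext a b
  fin_cases a <;> fin_cases b <;> simp [massMatrix] <;> ring

lemma interaction_eq (t : ℝ) :
    interaction t = Matrix.vecMulVec ![1, 1] (star ![1, 1]) +
      (Real.exp t - 1) • Matrix.vecMulVec ![0, 1] (star ![0, 1]) := by
  ext a b
  fin_cases a <;> fin_cases b <;> simp [interaction]

lemma posSemidef_massMatrix {p ρ : ℝ} (hp : 0 ≤ p) (hp1 : p ≤ 1) (hρ : 0 ≤ ρ) :
    (massMatrix p ρ).PosSemidef := by
  have h1 : 0 ≤ 1 - p := by linarith
  rw [massMatrix_eq]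
  exact (Matrix.posSemidef_vecMulVec_self_star _).add
    ((Matrix.posSemidef_vecMulVec_self_star _).smul (by positivity))

lemma posSemidef_interaction {t : ℝ} (ht : 0 ≤ t) : (interaction t).PosSemidef := by
  have h1 : 0 ≤ Real.exp t - 1 := by linarith [Real.one_le_exp ht]
  rw [interaction_eq]
  exact (Matrix.posSemidef_vecMulVec_self_star _).add
    ((Matrix.posSemidef_vecMulVec_self_star _).smul h1)

lemma posSemidef_mul_pow {m : Type*} [Fintype m] [DecidableEq m] {C K : Matrix m m ℝ}
    (hC : C.PosSemidef) (hK : K.PosSemidef) (n : ℕ) : (K * (C * K) ^ n).PosSemidef := by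
  induction n using Nat.twoStepInduction with
  | zero => simpa using hK
  | one =>
    have := hC.conjTranspose_mul_mul_same K
    rw [hK.1.eq] at this
    simpa [Matrix.mul_assoc] using this
  | more n ih _ =>
    have := ih.conjTranspose_mul_mul_same (C * K)
    rw [Matrix.conjTranspose_mul, hK.1.eq, hC.1.eq] at this
    rw [pow_succ, pow_succ']
    simpa only [Matrix.mul_assoc] using this

lemma trace_pow_add_two (N : Matrix (Fin 2) (Fin 2) ℝ) (n : ℕ) :
    (N ^ (n + 2)).trace = N.trace * (N ^ (n + 1)).trace - N.det * (N ^ n).trace := by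
  have h : N * N = N.trace • N - N.det • (1 : Matrix (Fin 2) (Fin 2) ℝ) := by
    ext a b
    fin_cases a <;> fin_cases b <;>
      simp [Matrix.mul_apply, Fin.sum_univ_two, Matrix.trace_fin_two, Matrix.det_fin_two] <;> ring
  rw [pow_add, pow_two, h, pow_succ]
  simp [mul_sub]

lemma pow_add_pow_sq_le {x y : ℝ} (hx : 0 ≤ x) (hy : 0 ≤ y) {n : ℕ} (hn : 2 ≤ n) :
    (x ^ n + y ^ n) ^ 2 ≤ (x ^ 2 + y ^ 2) ^ n := by
  induction n, hn using Nat.le_induction with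
  | base => exact le_rfl
  | succ n _ ih =>
    have hxn : 0 ≤ x ^ n := by positivity
    have hyn : 0 ≤ y ^ n := by positivity
    calc (x ^ (n + 1) + y ^ (n + 1)) ^ 2
        ≤ (x ^ n + y ^ n) ^ 2 * (x ^ 2 + y ^ 2) := by
          rw [pow_succ x, pow_succ y]
          nlinarith [sq_nonneg (x ^ n * y - y ^ n * x), mul_nonneg hxn hyn,
            mul_nonneg (mul_nonneg hxn hyn) (add_nonneg (sq_nonneg x) (sq_nonneg y))]
      _ ≤ _ := by
          rw [pow_succ (x ^ 2 + y ^ 2)]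
          gcongr

/-- A `2 × 2` matrix with nonnegative entries and determinant has nonnegative eigenvalues, whose
power sums are the traces of its powers. -/
lemma exists_trace_pow_eq (N : Matrix (Fin 2) (Fin 2) ℝ) (hN : ∀ a b, 0 ≤ N a b)
    (hdet : 0 ≤ N.det) :
    ∃ x y : ℝ, 0 ≤ x ∧ 0 ≤ y ∧ ∀ n, (N ^ n).trace = x ^ n + y ^ n := by
  set T := N.trace with hT
  have hT0 : 0 ≤ T := by
    rw [hT, Matrix.trace_fin_two]
    exact add_nonneg (hN _ _) (hN _ _)
  have hdisc : 0 ≤ T ^ 2 - 4 * N.det := by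
    rw [hT, Matrix.trace_fin_two, Matrix.det_fin_two]
    nlinarith [sq_nonneg (N 0 0 - N 1 1), mul_nonneg (hN 0 1) (hN 1 0)]
  set r := √(T ^ 2 - 4 * N.det) with hr
  have hr2 : r ^ 2 = T ^ 2 - 4 * N.det := Real.sq_sqrt hdisc
  have hr0 : 0 ≤ r := Real.sqrt_nonneg _
  have hrT : r ≤ T := Real.sqrt_le_iff.2 ⟨hT0, by linarith⟩
  refine ⟨(T + r) / 2, (T - r) / 2, by linarith, by linarith, fun n => ?_⟩
  have hdet' : N.det = (T + r) / 2 * ((T - r) / 2) := by linarith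
  induction n using Nat.twoStepInduction with
  | zero => simp [Matrix.trace_one]; norm_num
  | one => rw [pow_one, ← hT]; ring
  | more n ih1 ih2 =>
    rw [trace_pow_add_two, ih1, ih2, ← hT, hdet']
    ring

/-- **Lemma 2.1, Erdős–Rényi case, in MGF form**: (i) `m₁² ≤ m̃₂ ≤ m̃₁²`;
(ii) `m_ℓ ≤ m̃_ℓ` for all `ℓ ≥ 1`; (iii) `m̃_ℓ² ≤ m̃₂^ℓ` for all `ℓ ≥ 2`. -/
theorem er_mgf_inequalities (p ρ t : ℝ) (hp : 0 < p) (hp1 : p < 1)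
    (hρ : 0 < ρ) (hρ1 : ρ < 1) (ht : 0 < t) :
    (pathMGF p ρ t 1) ^ 2 ≤ cycleMGF p ρ t 2 ∧
    cycleMGF p ρ t 2 ≤ (cycleMGF p ρ t 1) ^ 2 ∧
    (∀ ℓ : ℕ, 1 ≤ ℓ → pathMGF p ρ t ℓ ≤ cycleMGF p ρ t ℓ) ∧
    (∀ ℓ : ℕ, 2 ≤ ℓ → (cycleMGF p ρ t ℓ) ^ 2 ≤ (cycleMGF p ρ t 2) ^ ℓ) := by
  have h1p : 0 < 1 - p := by linarith
  have hs : 0 < Real.exp t - 1 := by linarith [Real.one_lt_exp_iff.2 ht]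
  have hcyc := cycleMGF_eq_trace t hp.le hp1.le hρ.le hρ1.le
  have hpath := pathMGF_eq_dotProduct t hp.le hp1.le hρ.le hρ1.le
  have hN : ∀ a b, 0 ≤ (massMatrix p ρ * interaction t) a b := by
    intro a b
    rw [Matrix.mul_apply]
    refine Finset.sum_nonneg fun c _ =>
      mul_nonneg (massMatrix_nonneg hp.le hp1.le hρ.le hρ1.le _ _) ?_
    fin_cases c <;> fin_cases b <;> simp [interaction, Real.exp_nonneg]
  have hdet : 0 ≤ (massMatrix p ρ * interaction t).det := by
    rw [Matrix.det_mul]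
    exact mul_nonneg (posSemidef_massMatrix hp.le hp1.le hρ.le).det_nonneg
      (posSemidef_interaction ht.le).det_nonneg
  obtain ⟨x, y, hx, hy, hxy⟩ := exists_trace_pow_eq _ hN hdet
  have hcyc' : ∀ n, 1 ≤ n → cycleMGF p ρ t n = x ^ n + y ^ n := by
    intro n hn
    obtain ⟨k, rfl⟩ := Nat.exists_eq_add_of_le' hn
    rw [hcyc, hxy]
  refine ⟨?_, ?_, ?_, ?_⟩
  · have hm : pathMGF p ρ t 1 = 1 + p ^ 2 * (Real.exp t - 1) := by
      rw [hpath 0]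
      simp [interaction, Matrix.mulVec, dotProduct, Fin.sum_univ_two]
      ring
    have hc : cycleMGF p ρ t 2 = (1 + p ^ 2 * (Real.exp t - 1)) ^ 2 +
        2 * (ρ * p * (1 - p)) * (p * (Real.exp t - 1)) ^ 2 +
        (ρ * p * (1 - p) * (Real.exp t - 1)) ^ 2 := by
      rw [hcyc 1, pow_two, Matrix.trace_fin_two]
      simp [interaction, massMatrix, Matrix.mul_apply, Fin.sum_univ_two]
      ring
    rw [hm, hc, add_assoc]
    exact le_add_of_nonneg_right (by positivity)
  · rw [hcyc' 2 (by norm_num), hcyc' 1 le_rfl]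
    nlinarith [mul_nonneg hx hy]
  · intro n hn
    obtain ⟨k, rfl⟩ := Nat.exists_eq_add_of_le' hn
    have hpsd := (posSemidef_mul_pow (posSemidef_massMatrix hp.le hp1.le hρ.le)
      (posSemidef_interaction ht.le) k).dotProduct_mulVec_nonneg ![-1, 1]
    rw [hcyc, hpath, pow_succ', Matrix.mul_assoc]
    generalize interaction t * (massMatrix p ρ * interaction t) ^ k = Q at hpsd ⊢
    have hc : 0 ≤ ρ * p * (1 - p) := by positivity
    have hkey : (massMatrix p ρ * Q).trace = ![1 - p, p] ⬝ᵥ (Q.mulVec ![1 - p, p]) +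
        ρ * p * (1 - p) * (star ![-1, 1] ⬝ᵥ (Q.mulVec ![-1, 1])) := by
      simp only [Matrix.trace_fin_two, Matrix.mul_apply, Matrix.mulVec, dotProduct,
        Fin.sum_univ_two]
      simp [massMatrix]
      ring
    rw [hkey]
    exact le_add_of_nonneg_right (mul_nonneg hc hpsd)
  · intro n hn
    rw [hcyc' n (by omega), hcyc' 2 (by norm_num)]
    exact pow_add_pow_sq_le hx hy hn

end ERMGF
end

section
/- (Explicit cumulant bounds in the Erdős–Rényi model; proof of Lemma 3.1.) Let p ∈ (0,1), ρ ∈ (0,1), t > 0, and set p₁₁ = p² + ρp(1−p) and γ = ρ(1−p)/p. Then: (i) 1 + 2p²(e^t − 1) + p₁₁²(e^t − 1)² ≤ exp( p²(e^{2t} − 1) ); and (ii) (1 + p₁₁(e^t − 1))² ≤ (1 + 2p²(e^t − 1) + p₁₁²(e^t − 1)²)·exp( γ/(γ+2) ). (Equivalently: κ₂^C(t) = log(1 + 2p²(e^t−1) + p₁₁²(e^t−1)²) ≤ p²(e^{2t}−1), and κ₁^C(t) − (1/2)κ₂^C(t) ≤ γ/(2(γ+2)) where κ₁^C(t) = log(1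 + p₁₁(e^t−1)).) -/
/-- If `0 < a ≤ q` and `y` is `(q - a) / (q + a)`, then `(1 + qx)²` exceeds `1 + 2ax + q²x²` by at
most the factor `exp y`. -/
lemma sq_one_add_mul_le_mul_exp {a q x : ℝ} (ha : 0 < a) (haq : a ≤ q) (hx : 0 ≤ x) :
    (1 + q * x) ^ 2 ≤ (1 + 2 * a * x + q ^ 2 * x ^ 2) * Real.exp ((q - a) / (q + a)) := by
  have hq : 0 < q + a := by linarith
  have hD : 2 * (q + a) * x ≤ 1 + 2 * a * x + q ^ 2 * x ^ 2 := by
    nlinarith [sq_nonneg (1 - q * x)]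
  calc (1 + q * x) ^ 2
      = (1 + 2 * a * x + q ^ 2 * x ^ 2) + (2 * (q + a) * x) * ((q - a) / (q + a)) := by
        field_simp
        ring
    _ ≤ (1 + 2 * a * x + q ^ 2 * x ^ 2)
          + (1 + 2 * a * x + q ^ 2 * x ^ 2) * ((q - a) / (q + a)) := by
        have := div_nonneg (sub_nonneg.2 haq) hq.le
        gcongr
    _ = (1 + 2 * a * x + q ^ 2 * x ^ 2) * ((q - a) / (q + a) + 1) := by ring
    _ ≤ _ := by
        gcongr
        exact Real.add_one_le_exp _

/-- **Cumulant bounds in the Erdős–Rényi model** (proof of Lemma 3.1):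
with `p₁₁ = p² + ρp(1−p)` and `γ = ρ(1−p)/p`, for `t > 0`:
(i) `1 + 2p²(e^t−1) + p₁₁²(e^t−1)² ≤ exp(p²(e^{2t}−1))`, and
(ii) `(1 + p₁₁(e^t−1))² ≤ (1 + 2p²(e^t−1) + p₁₁²(e^t−1)²)·exp(γ/(γ+2))`. -/
theorem er_cumulant_bounds (p ρ t : ℝ) (hp : 0 < p) (hp1 : p < 1)
    (hρ : 0 < ρ) (hρ1 : ρ < 1) (ht : 0 < t) :
    1 + 2 * p ^ 2 * (Real.exp t - 1)
        + (p ^ 2 + ρ * p * (1 - p)) ^ 2 * (Real.exp t - 1) ^ 2 ≤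
      Real.exp (p ^ 2 * (Real.exp (2 * t) - 1)) ∧
    (1 + (p ^ 2 + ρ * p * (1 - p)) * (Real.exp t - 1)) ^ 2 ≤
      (1 + 2 * p ^ 2 * (Real.exp t - 1)
          + (p ^ 2 + ρ * p * (1 - p)) ^ 2 * (Real.exp t - 1) ^ 2) *
        Real.exp ((ρ * (1 - p) / p) / (ρ * (1 - p) / p + 2)) := by
  have hx : 0 ≤ Real.exp t - 1 := by linarith [Real.add_one_le_exp t]
  have hexp : Real.exp (2 * t) = Real.exp t ^ 2 := by
    rw [← Real.exp_nat_mul]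
    norm_num
  have hle : p ^ 2 ≤ p ^ 2 + ρ * p * (1 - p) := by
    have : 0 < 1 - p := by linarith
    have : 0 < ρ * p * (1 - p) := by positivity
    linarith
  have hqp : p ^ 2 + ρ * p * (1 - p) ≤ p := by
    nlinarith [mul_pos (mul_pos hp (sub_pos.2 hp1)) (sub_pos.2 hρ1)]
  constructor
  · have hq : (p ^ 2 + ρ * p * (1 - p)) ^ 2 ≤ p ^ 2 :=
      pow_le_pow_left₀ ((sq_nonneg p).trans hle) hqp 2
    calc _ ≤ 1 + 2 * p ^ 2 * (Real.exp t - 1) + p ^ 2 * (Real.exp t - 1) ^ 2 := by gcongr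
      _ = p ^ 2 * (Real.exp (2 * t) - 1) + 1 := by
        rw [hexp]
        ring
      _ ≤ _ := Real.add_one_le_exp _
  · have hratio : ρ * (1 - p) / p / (ρ * (1 - p) / p + 2) =
        (p ^ 2 + ρ * p * (1 - p) - p ^ 2) / (p ^ 2 + ρ * p * (1 - p) + p ^ 2) := by
      have : 0 < p ^ 2 + ρ * p * (1 - p) + p ^ 2 := by positivity
      have : 0 < ρ * (1 - p) / p + 2 := by
        have : 0 ≤ ρ * (1 - p) / p := by
          have : 0 < 1 - p := by linarith
          positivity
        linarith
      rw [div_eq_div_iff (by positivity) (by positivity)]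
      field_simp
      ring
    rw [hratio]
    exact sq_one_add_mul_le_mul_exp (by positivity) hle hx
end

section
/- (Lemma 2.1, Gaussian Wigner case with f(x,y) = xy, in moment generating function form.) Fix ρ ∈ (0,1) and 0 < t < 1/(1+ρ). For an integer ℓ ≥ 1, define m_ℓ := E[ exp( t·Σ_{i=1}^{ℓ} A_{i−1}·B_i ) ] where ((A_i,B_i))_{i=0}^{ℓ} are i.i.d. pairs of standard Gaussians with correlation ρ, and m̃_ℓ := E[ exp( t·Σ_{i ∈ ℤ/ℓℤ} A_i·B_{i+1} ) ] where ((A_i,B_i))_{i ∈ ℤ/ℓℤ} are i.i.d. such pairs. Then all these expectations are finite, m̃_ℓ = (λ₁^{ℓ/2} − λ₂^{ℓ/2})^{−1} where λ₁ > λ₂ > 0 are the two roots of x² − (1 − t²(1−ρ²))x + t²ρ² = 0, and: (i) m₁² ≤ m̃₂ ≤ m̃₁²; (ii) for every ℓ ≥ 1, m_ℓ < m̃_ℓ; (iii) for every ℓ ≥ 2, m̃_ℓ² ≤ m̃₂^ℓ. -/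
open MeasureTheory ProbabilityTheory

namespace GaussMGF

/-- The standard Gaussian measure on `ℝ`. -/
noncomputable def stdGauss : Measure ℝ := gaussianReal 0 1

/-- The law of a pair of standard Gaussians with correlation `ρ`:
the distribution of `(A, ρ·A + √(1−ρ²)·Z)` for `A, Z` independent standard normal. -/
noncomputable def gaussPair (ρ : ℝ) : Measure (ℝ × ℝ) :=
  (stdGauss.prod stdGauss).map fun z => (z.1, ρ * z.1 + Real.sqrt (1 - ρ ^ 2) * z.2)

/-- The Gaussian path MGF for `f(x,y) = xy`. -/
noncomputable def gaussPathMGF (ρ t : ℝ) (ℓ : ℕ) : ℝ :=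
  ∫ ω : Fin (ℓ + 1) → ℝ × ℝ,
    Real.exp (t * ∑ i : Fin ℓ, (ω i.castSucc).1 * (ω i.succ).2)
    ∂(Measure.pi fun _ => gaussPair ρ)

/-- The Gaussian cycle MGF for `f(x,y) = xy`. -/
noncomputable def gaussCycleMGF (ρ t : ℝ) (ℓ : ℕ) : ℝ :=
  ∫ ω : Fin ℓ → ℝ × ℝ,
    Real.exp (t * ∑ i : Fin ℓ, (ω i).1 * (ω (finRotate ℓ i)).2)
    ∂(Measure.pi fun _ => gaussPair ρ)

/-- The Gaussian integral of the exponential of a quadratic polynomial. -/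
lemma lintegral_stdGauss_exp_quadratic {c d k K : ℝ} (hc : c < 1) (hK : 0 ≤ K) {g : ℝ → ℝ}
    (hg : ∀ x, g x = c * x ^ 2 / 2 + d * x + k) :
    ∫⁻ x, ENNReal.ofReal (K * Real.exp (g x)) ∂stdGauss =
      ENNReal.ofReal (K * (Real.sqrt (1 - c))⁻¹ * Real.exp (d ^ 2 / (2 * (1 - c)) + k)) := by
  have hc' : 0 < 1 - c := sub_pos.2 hc
  have hmeas : Measurable fun x => ENNReal.ofReal (K * Real.exp (g x)) := by
    simp only [hg]; fun_prop
  let v : NNReal := ⟨(1 - c)⁻¹, (inv_pos.2 hc').le⟩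
  have hv : v ≠ 0 := fun h => (inv_pos.2 hc').ne' (congrArg NNReal.toReal h)
  have hvc : (v : ℝ) = (1 - c)⁻¹ := rfl
  rw [stdGauss, gaussianReal_of_var_ne_zero 0 one_ne_zero,
    lintegral_withDensity_eq_lintegral_mul _ (measurable_gaussianPDF 0 1) hmeas]
  have key : ∀ x, (gaussianPDF 0 1 * fun x => ENNReal.ofReal (K * Real.exp (g x))) x =
      ENNReal.ofReal (K * (Real.sqrt (1 - c))⁻¹ * Real.exp (d ^ 2 / (2 * (1 - c)) + k)) *
        ENNReal.ofReal (gaussianPDFReal (d / (1 - c)) v x) := by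
    intro x
    simp only [Pi.mul_apply, gaussianPDF]
    rw [← ENNReal.ofReal_mul (gaussianPDFReal_nonneg _ _ _),
      ← ENNReal.ofReal_mul (by positivity)]
    congr 1
    simp only [gaussianPDFReal, hvc, NNReal.coe_one, hg]
    have hs : Real.sqrt (2 * Real.pi * (1 - c)⁻¹) =
        Real.sqrt (2 * Real.pi * 1) * (Real.sqrt (1 - c))⁻¹ := by
      rw [Real.sqrt_mul (by positivity), Real.sqrt_inv, mul_one]
    have hsc : Real.sqrt (1 - c) ≠ 0 := (Real.sqrt_pos.2 hc').ne'
    have hexp : Real.exp (-(x - 0) ^ 2 / (2 * 1)) * Real.exp (c * x ^ 2 / 2 + d * x + k) =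
        Real.exp (d ^ 2 / (2 * (1 - c)) + k) *
          Real.exp (-(x - d / (1 - c)) ^ 2 / (2 * (1 - c)⁻¹)) := by
      rw [← Real.exp_add, ← Real.exp_add]
      congr 1
      field_simp
      ring
    rw [hs, mul_inv, inv_inv]
    calc _ = (Real.sqrt (2 * Real.pi * 1))⁻¹ * K *
          (Real.exp (-(x - 0) ^ 2 / (2 * 1)) * Real.exp (c * x ^ 2 / 2 + d * x + k)) := by ring
      _ = _ := by
        rw [hexp]
        field_simp
  rw [lintegral_congr key, lintegral_const_mul _ (by fun_prop),
    lintegral_gaussianPDFReal_eq_one _ hv, mul_one]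

instance : IsProbabilityMeasure stdGauss := by
  unfold stdGauss; infer_instance

instance (ρ : ℝ) : IsProbabilityMeasure (gaussPair ρ) :=
  Measure.isProbabilityMeasure_map (by fun_prop)

lemma lintegral_gaussPair (ρ : ℝ) {f : ℝ × ℝ → ENNReal} (hf : Measurable f) :
    ∫⁻ p, f p ∂gaussPair ρ =
      ∫⁻ a, ∫⁻ z, f (a, ρ * a + Real.sqrt (1 - ρ ^ 2) * z) ∂stdGauss ∂stdGauss := by
  rw [gaussPair, lintegral_map hf (by fun_prop), lintegral_prod]
  exact (hf.comp (by fun_prop)).aemeasurable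

lemma lintegral_pi_fin_succ {α : Type*} [MeasurableSpace α] (μ : Measure α) [SigmaFinite μ]
    {n : ℕ} {f : (Fin (n + 1) → α) → ENNReal} (hf : Measurable f) :
    ∫⁻ ω, f ω ∂(Measure.pi fun _ => μ) =
      ∫⁻ p, ∫⁻ w : Fin n → α, f (Fin.cons p w) ∂(Measure.pi fun _ => μ) ∂μ := by
  have h := (measurePreserving_piFinSuccAbove (fun _ : Fin (n + 1) => μ) 0).symm
  rw [← h.lintegral_comp hf, lintegral_prod]
  · simp [MeasurableEquiv.piFinSuccAbove, Fin.insertNthEquiv]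
  · exact (hf.comp (MeasurableEquiv.measurable _)).aemeasurable

/-- The statistic `a·B₁ + A₁·B₂ + ⋯ + A_{n-1}·B_n + A_n·b` of a chain of `n` pairs with
boundary values `a` and `b`. -/
def chainSum : (n : ℕ) → ℝ → (Fin n → ℝ × ℝ) → ℝ → ℝ
  | 0, a, _, b => a * b
  | n + 1, a, ω, b => a * (ω 0).2 + chainSum n (ω 0).1 (Fin.tail ω) b

lemma measurable_chainSum (n : ℕ) :
    Measurable fun q : ℝ × (Fin n → ℝ × ℝ) × ℝ => chainSum n q.1 q.2.1 q.2.2 := by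
  induction n with
  | zero => simp only [chainSum]; fun_prop
  | succ n ih =>
    simp only [chainSum]
    have h : Measurable fun q : ℝ × (Fin (n + 1) → ℝ × ℝ) × ℝ =>
        ((q.2.1 0).1, (Fin.tail q.2.1 : Fin n → ℝ × ℝ), q.2.2) := by
      unfold Fin.tail; fun_prop
    exact Measurable.add (by fun_prop) (ih.comp h)

lemma sum_add_eq_chainSum (n : ℕ) (ω : Fin (n + 1) → ℝ × ℝ) (b : ℝ) :
    ∑ i : Fin n, (ω i.castSucc).1 * (ω i.succ).2 + (ω (Fin.last n)).1 * b =
      chainSum n (ω 0).1 (Fin.tail ω) b := by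
  induction n with
  | zero => simp [chainSum]
  | succ n ih =>
    rw [Fin.sum_univ_succ, chainSum, ← ih (Fin.tail ω), add_assoc]
    simp [Fin.tail]

lemma path_sum_eq_chainSum (n : ℕ) (ω : Fin (n + 1) → ℝ × ℝ) :
    ∑ i : Fin n, (ω i.castSucc).1 * (ω i.succ).2 = chainSum n (ω 0).1 (Fin.tail ω) 0 := by
  rw [← sum_add_eq_chainSum, mul_zero, add_zero]

lemma cycle_sum_eq_chainSum (n : ℕ) (ω : Fin (n + 1) → ℝ × ℝ) :
    ∑ i : Fin (n + 1), (ω i).1 * (ω (finRotate (n + 1) i)).2 =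
      chainSum n (ω 0).1 (Fin.tail ω) (ω 0).2 := by
  rw [← sum_add_eq_chainSum, Fin.sum_univ_castSucc, finRotate_last]
  congr 1
  refine Finset.sum_congr rfl fun i _ => ?_
  rw [show i.castSucc = (⟨i, i.is_lt.trans n.lt_succ_self⟩ : Fin (n + 1)) from rfl,
    finRotate_of_lt i.is_lt]
  rfl

/-- The bivariate Gaussian integral of the exponential of a symmetric quadratic form. -/
lemma lintegral_gaussPair_exp_quadratic {ρ c δ K : ℝ} (hρ0 : ρ ≠ 0) (hρ : ρ ^ 2 < 1) (hc : c < 1)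
    (hK : 0 ≤ K) (hD : 0 < 1 - 2 * c - 2 * ρ * δ + (1 - ρ ^ 2) * (c ^ 2 - δ ^ 2)) :
    ∫⁻ p, ENNReal.ofReal (K * Real.exp (c * (p.1 ^ 2 + p.2 ^ 2) / 2 + δ * (p.1 * p.2)))
      ∂gaussPair ρ =
    ENNReal.ofReal (K *
      (Real.sqrt (1 - 2 * c - 2 * ρ * δ + (1 - ρ ^ 2) * (c ^ 2 - δ ^ 2)))⁻¹) := by
  have hs : Real.sqrt (1 - ρ ^ 2) ^ 2 = 1 - ρ ^ 2 := Real.sq_sqrt (by linarith)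
  have hρ2 : 0 < ρ ^ 2 := by positivity
  have hcs : 0 < 1 - c * (1 - ρ ^ 2) := by nlinarith
  rw [lintegral_gaussPair ρ (by fun_prop)]
  have hz : ∀ x : ℝ, ∫⁻ z, ENNReal.ofReal (K * Real.exp
      (c * (x ^ 2 + (ρ * x + Real.sqrt (1 - ρ ^ 2) * z) ^ 2) / 2 +
        δ * (x * (ρ * x + Real.sqrt (1 - ρ ^ 2) * z)))) ∂stdGauss =
      ENNReal.ofReal (K * (Real.sqrt (1 - c * (1 - ρ ^ 2)))⁻¹ * Real.exp
        ((1 - (1 - 2 * c - 2 * ρ * δ + (1 - ρ ^ 2) * (c ^ 2 - δ ^ 2)) /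
          (1 - c * (1 - ρ ^ 2))) * x ^ 2 / 2)) := by
    intro x
    rw [lintegral_stdGauss_exp_quadratic (c := c * (1 - ρ ^ 2))
      (d := Real.sqrt (1 - ρ ^ 2) * (δ + c * ρ) * x)
      (k := c * (1 + ρ ^ 2) * x ^ 2 / 2 + δ * ρ * x ^ 2) (by linarith) hK
      (fun z => by linear_combination c * z ^ 2 / 2 * hs)]
    congr 3
    rw [mul_pow, mul_pow, hs]
    generalize hw : 1 - c * (1 - ρ ^ 2) = w at hcs
    field_simp
    rw [← hw]
    ring
  rw [lintegral_congr hz, lintegral_stdGauss_exp_quadratic (d := 0) (k := 0)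
    (sub_lt_self _ (div_pos hD hcs)) (by positivity) (fun z => by ring)]
  congr 1
  rw [sub_sub_cancel, Real.sqrt_div hD.le]
  have := (Real.sqrt_pos.2 hcs).ne'
  simp
  field_simp

/-- Positive solutions of the three-term recurrence satisfied by the determinants
`E[exp(t·∑ A_{i-1} B_i)]^{-2}` of the paths, shifted by one index. -/
structure IsPathDet (ρ t : ℝ) (E : ℕ → ℝ) : Prop where
  pos : ∀ n, 0 < E n
  zero : E 0 = 1
  one : E 1 = 1
  recurrence : ∀ n, E (n + 2) = (1 - t ^ 2 * (1 - ρ ^ 2)) * E (n + 1) - t ^ 2 * ρ ^ 2 * E n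

namespace IsPathDet

variable {ρ t : ℝ} {E : ℕ → ℝ}

lemma casoratian (hE : IsPathDet ρ t E) (n : ℕ) :
    E (n + 1) ^ 2 - E (n + 2) * E n = t ^ 2 * (t * ρ) ^ (2 * n) := by
  induction n with
  | zero => rw [hE.recurrence 0]; simp only [zero_add, hE.zero, hE.one]; ring
  | succ n ih =>
    rw [hE.recurrence (n + 1), mul_add, pow_add]
    have := hE.recurrence n
    linear_combination (t * ρ) ^ 2 * ih + E (n + 2) * this

lemma lintegral_chain (hE : IsPathDet ρ t E) (hρ : ρ ^ 2 ≤ 1) (n : ℕ) (a b : ℝ) :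
    ∫⁻ ω : Fin n → ℝ × ℝ, ENNReal.ofReal (Real.exp (t * chainSum n a ω b))
      ∂(Measure.pi fun _ => gaussPair ρ) =
    ENNReal.ofReal ((Real.sqrt (E n))⁻¹ * Real.exp
      ((1 - E (n + 1) / E n) * (a ^ 2 + b ^ 2) / 2 + t * (t * ρ) ^ n / E n * (a * b))) := by
  induction n generalizing a with
  | zero => simp [chainSum, hE.zero, hE.one]
  | succ n ih =>
    have hm := measurable_chainSum (n + 1)
    have hm' := measurable_chainSum n
    have hn := hE.pos n
    have hn1 := hE.pos (n + 1)
    have hs : Real.sqrt (1 - ρ ^ 2) ^ 2 = 1 - ρ ^ 2 := Real.sq_sqrt (by linarith)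
    rw [lintegral_pi_fin_succ]
    swap
    · have : Measurable fun ω : Fin (n + 1) → ℝ × ℝ => chainSum (n + 1) a ω b :=
        hm.comp (g := fun q : ℝ × (Fin (n + 1) → ℝ × ℝ) × ℝ => chainSum (n + 1) q.1 q.2.1 q.2.2)
          (f := fun ω => (a, ω, b)) (by fun_prop)
      fun_prop
    have inner : ∀ p : ℝ × ℝ, ∫⁻ w : Fin n → ℝ × ℝ, ENNReal.ofReal (Real.exp
        (t * chainSum (n + 1) a (Fin.cons p w) b)) ∂(Measure.pi fun _ => gaussPair ρ) =
        ENNReal.ofReal ((Real.sqrt (E n))⁻¹ * Real.exp (t * (a * p.2) +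
          ((1 - E (n + 1) / E n) * (p.1 ^ 2 + b ^ 2) / 2 +
            t * (t * ρ) ^ n / E n * (p.1 * b)))) := by
      intro p
      simp only [chainSum, Fin.cons_zero, Fin.tail_cons, mul_add t, Real.exp_add (t * (a * p.2)),
        ENNReal.ofReal_mul (Real.exp_nonneg (t * (a * p.2)))]
      rw [lintegral_const_mul _ ?_, ih, ← ENNReal.ofReal_mul (Real.exp_nonneg _)]
      · congr 1; ring
      · have : Measurable fun ω : Fin n → ℝ × ℝ => chainSum n p.1 ω b :=
          hm'.comp (g := fun q : ℝ × (Fin n → ℝ × ℝ) × ℝ => chainSum n q.1 q.2.1 q.2.2)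
            (f := fun ω => (p.1, ω, b)) (by fun_prop)
        fun_prop
    rw [lintegral_congr inner, lintegral_gaussPair ρ (by fun_prop)]
    have hz : ∀ x : ℝ, ∫⁻ z, ENNReal.ofReal ((Real.sqrt (E n))⁻¹ * Real.exp
        (t * (a * (ρ * x + Real.sqrt (1 - ρ ^ 2) * z)) +
          ((1 - E (n + 1) / E n) * (x ^ 2 + b ^ 2) / 2 +
            t * (t * ρ) ^ n / E n * (x * b)))) ∂stdGauss =
        ENNReal.ofReal ((Real.sqrt (E n))⁻¹ * Real.exp
          (t ^ 2 * (1 - ρ ^ 2) * a ^ 2 / 2 + t * a * ρ * x +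
          ((1 - E (n + 1) / E n) * (x ^ 2 + b ^ 2) / 2 +
            t * (t * ρ) ^ n / E n * (x * b)))) := by
      intro x
      rw [lintegral_stdGauss_exp_quadratic (c := 0) (d := t * a * Real.sqrt (1 - ρ ^ 2))
        (k := t * a * ρ * x + ((1 - E (n + 1) / E n) * (x ^ 2 + b ^ 2) / 2 +
            t * (t * ρ) ^ n / E n * (x * b))) one_pos (by positivity) (fun z => by ring)]
      congr 2
      · simp
      · rw [mul_pow, hs]; congr 1; ring
    rw [lintegral_congr hz, lintegral_stdGauss_exp_quadratic (c := 1 - E (n + 1) / E n)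
      (d := t * a * ρ + t * (t * ρ) ^ n / E n * b)
      (k := t ^ 2 * (1 - ρ ^ 2) * a ^ 2 / 2 + (1 - E (n + 1) / E n) * b ^ 2 / 2)
      (sub_lt_self _ (div_pos hn1 hn)) (by positivity) (fun z => by ring)]
    congr 2
    · rw [sub_sub_cancel, Real.sqrt_div hn1.le]
      have := (Real.sqrt_pos.2 hn).ne'
      field_simp
    · have hc := hE.casoratian n
      have hc' : E (n + 1 + 1) * E n = E (n + 1) ^ 2 - t ^ 2 * (t * ρ) ^ (2 * n) := by
        linear_combination -hc
      congr 1
      rw [sub_sub_cancel]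
      have hr : E (n + 1 + 1) = (1 - t ^ 2 * (1 - ρ ^ 2)) * E (n + 1) - t ^ 2 * ρ ^ 2 * E n :=
        hE.recurrence n
      have h1 : (1 - E (n + 1 + 1) / E (n + 1)) * (a ^ 2 + b ^ 2) =
          (t ^ 2 * (1 - ρ ^ 2) + t ^ 2 * ρ ^ 2 * E n / E (n + 1)) * a ^ 2 +
          (1 - E (n + 1) / E n + t ^ 2 * (t * ρ) ^ (2 * n) / (E n * E (n + 1))) * b ^ 2 := by
        have h2 : 1 - E (n + 1 + 1) / E (n + 1) =
            t ^ 2 * (1 - ρ ^ 2) + t ^ 2 * ρ ^ 2 * E n / E (n + 1) := by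
          rw [hr]; field_simp; ring
        have h3 : 1 - E (n + 1 + 1) / E (n + 1) =
            1 - E (n + 1) / E n + t ^ 2 * (t * ρ) ^ (2 * n) / (E n * E (n + 1)) := by
          field_simp; linear_combination -hc'
        rw [mul_add, ← h2, ← h3]
      rw [h1]
      field_simp
      ring

lemma lintegral_path (hE : IsPathDet ρ t E) (hρ : ρ ^ 2 ≤ 1) (n : ℕ) :
    ∫⁻ ω : Fin (n + 1) → ℝ × ℝ, ENNReal.ofReal
      (Real.exp (t * ∑ i : Fin n, (ω i.castSucc).1 * (ω i.succ).2))
      ∂(Measure.pi fun _ => gaussPair ρ) = ENNReal.ofReal (Real.sqrt (E (n + 1)))⁻¹ := by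
  have hn := hE.pos n
  have hn1 := hE.pos (n + 1)
  rw [lintegral_pi_fin_succ _ (by fun_prop)]
  simp only [path_sum_eq_chainSum, Fin.cons_zero, Fin.tail_cons, hE.lintegral_chain hρ]
  rw [lintegral_gaussPair ρ (by fun_prop)]
  simp only [lintegral_const, measure_univ, mul_one]
  rw [lintegral_stdGauss_exp_quadratic (c := 1 - E (n + 1) / E n) (d := 0) (k := 0)
    (sub_lt_self _ (div_pos hn1 hn)) (by positivity) (fun z => by ring)]
  congr 1
  rw [sub_sub_cancel, Real.sqrt_div hn1.le]
  have := (Real.sqrt_pos.2 hn).ne'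
  simp
  field_simp

lemma lintegral_cycle (hE : IsPathDet ρ t E) (hρ0 : ρ ≠ 0) (hρ : ρ ^ 2 < 1) (n : ℕ) {V : ℝ}
    (hV : 0 < V) (hVE : V = ρ ^ 2 * (2 * E (n + 1) - E n) + (1 - ρ ^ 2) * E (n + 2)
      - 2 * (t * ρ) ^ (n + 1)) :
    ∫⁻ ω : Fin (n + 1) → ℝ × ℝ, ENNReal.ofReal
      (Real.exp (t * ∑ i : Fin (n + 1), (ω i).1 * (ω (finRotate (n + 1) i)).2))
      ∂(Measure.pi fun _ => gaussPair ρ) = ENNReal.ofReal (Real.sqrt V)⁻¹ := by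
  have hn := hE.pos n
  have hn1 := hE.pos (n + 1)
  have hD : 1 - 2 * (1 - E (n + 1) / E n) - 2 * ρ * (t * (t * ρ) ^ n / E n) +
      (1 - ρ ^ 2) * ((1 - E (n + 1) / E n) ^ 2 - (t * (t * ρ) ^ n / E n) ^ 2) = V / E n := by
    have hc := hE.casoratian n
    rw [hVE]
    field_simp
    rw [pow_mul'] at hc
    linear_combination (1 - ρ ^ 2) * hc
  rw [lintegral_pi_fin_succ _ (by fun_prop)]
  simp only [cycle_sum_eq_chainSum, Fin.cons_zero, Fin.tail_cons, hE.lintegral_chain hρ.le]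
  rw [lintegral_gaussPair_exp_quadratic hρ0 hρ (sub_lt_self _ (div_pos hn1 hn)) (by positivity)
    (hD ▸ div_pos hV hn), hD, Real.sqrt_div hV.le]
  congr 1
  have := (Real.sqrt_pos.2 hn).ne'
  field_simp

end IsPathDet

lemma integrable_and_integral_eq_of_lintegral_eq {α : Type*} [MeasurableSpace α] {μ : Measure α}
    {f : α → ℝ} {c : ℝ} (hf : Measurable f) (hf0 : ∀ x, 0 ≤ f x) (hc : 0 ≤ c)
    (h : ∫⁻ x, ENNReal.ofReal (f x) ∂μ = ENNReal.ofReal c) :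
    Integrable f μ ∧ ∫ x, f x ∂μ = c := by
  constructor
  · rw [← lintegral_ofReal_ne_top_iff_integrable hf.aestronglyMeasurable (ae_of_all _ hf0), h]
    exact ENNReal.ofReal_ne_top
  · rw [integral_eq_lintegral_of_nonneg_ae (ae_of_all _ hf0) hf.aestronglyMeasurable, h,
      ENNReal.toReal_ofReal hc]

/-- The parameters `μ = √λ₁` and `ν = √λ₂`. -/
lemma exists_sqrt_roots {ρ t : ℝ} (hρ : 0 < ρ) (hρ1 : ρ < 1) (ht : 0 < t)
    (ht' : t < 1 / (1 + ρ)) :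
    ∃ μ ν : ℝ, 0 < ν ∧ ν < μ ∧ μ < 1 ∧ μ * ν = t * ρ ∧
      μ ^ 2 + ν ^ 2 = 1 - t ^ 2 * (1 - ρ ^ 2) := by
  have h1 : 0 < 1 - t * (1 + ρ) := by
    rw [lt_div_iff₀ (by linarith)] at ht'; linarith
  have htρ : 0 < t * ρ := mul_pos ht hρ
  have hs : 0 < 1 - ρ ^ 2 := by nlinarith
  have ht2 : 0 < t ^ 2 * (1 - ρ ^ 2) := by positivity
  have hv : 0 < 1 - t ^ 2 * (1 - ρ ^ 2) - 2 * (t * ρ) := by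
    have : 0 < (1 - t * (1 + ρ)) * (1 + t * (1 - ρ)) :=
      mul_pos h1 (by nlinarith)
    linarith
  set v := 1 - t ^ 2 * (1 - ρ ^ 2) - 2 * (t * ρ) with hv_def
  set u := 1 - t ^ 2 * (1 - ρ ^ 2) + 2 * (t * ρ) with hu_def
  have huv : v < u := by linarith
  have hsv := Real.sqrt_pos.2 hv
  have hlt := Real.sqrt_lt_sqrt hv.le huv
  have hu2 := Real.sq_sqrt (hv.trans huv).le
  have hv2 := Real.sq_sqrt hv.le
  have hsum : ((√u + √v) / 2) ^ 2 + ((√u - √v) / 2) ^ 2 = 1 - t ^ 2 * (1 - ρ ^ 2) := by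
    linarith
  refine ⟨(√u + √v) / 2, (√u - √v) / 2, by linarith, by linarith, ?_, by linarith, hsum⟩
  nlinarith [sq_nonneg ((√u - √v) / 2)]

/-- The determinants of the paths, in terms of the square roots of the characteristic roots. -/
noncomputable def pathDet (μ ν : ℝ) (k : ℕ) : ℝ :=
  ((1 - ν ^ 2) * (μ ^ 2) ^ k - (1 - μ ^ 2) * (ν ^ 2) ^ k) / (μ ^ 2 - ν ^ 2)

section Scalar

variable {μ ν : ℝ}

lemma isPathDet_pathDet {ρ t : ℝ} (hν : 0 < ν) (hνμ : ν < μ) (hμ : μ < 1)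
    (hprod : μ * ν = t * ρ) (hsum : μ ^ 2 + ν ^ 2 = 1 - t ^ 2 * (1 - ρ ^ 2)) :
    IsPathDet ρ t (pathDet μ ν) := by
  have hsq : ν ^ 2 < μ ^ 2 := by nlinarith
  have hμ1 : μ ^ 2 < 1 := by nlinarith
  have hd : 0 < μ ^ 2 - ν ^ 2 := sub_pos.2 hsq
  refine ⟨fun n => div_pos ?_ hd, ?_, ?_, fun n => ?_⟩
  · have h1 : (ν ^ 2) ^ n ≤ (μ ^ 2) ^ n := pow_le_pow_left₀ (by positivity) hsq.le n
    have h2 : 0 < (ν ^ 2) ^ n := by positivity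
    nlinarith
  · rw [pathDet, div_eq_one_iff_eq hd.ne']; ring
  · rw [pathDet, div_eq_one_iff_eq hd.ne']; ring
  · rw [← hsum, ← mul_pow, ← hprod]
    simp only [pathDet]
    field_simp
    ring

lemma pathDet_lincomb {ρ t : ℝ} (hν : 0 < ν) (hνμ : ν < μ)
    (hprod : μ * ν = t * ρ) (hsum : μ ^ 2 + ν ^ 2 = 1 - t ^ 2 * (1 - ρ ^ 2)) (n : ℕ) :
    (μ ^ (n + 1) - ν ^ (n + 1)) ^ 2 =
      ρ ^ 2 * (2 * pathDet μ ν (n + 1) - pathDet μ ν n) + (1 - ρ ^ 2) * pathDet μ ν (n + 2)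
        - 2 * (t * ρ) ^ (n + 1) := by
  have hd : 0 < μ ^ 2 - ν ^ 2 := by nlinarith
  have ht2 : t ^ 2 = (1 - μ ^ 2) * (1 - ν ^ 2) := by
    linear_combination hsum - (μ * ν + t * ρ) * hprod
  have hρt : ρ ^ 2 * ((1 - μ ^ 2) * (1 - ν ^ 2)) = μ ^ 2 * ν ^ 2 := by
    rw [← ht2]; linear_combination -(μ * ν + t * ρ) * hprod
  have hμn : (μ ^ 2) ^ n = (μ ^ n) ^ 2 := by ring
  have hνn : (ν ^ 2) ^ n = (ν ^ n) ^ 2 := by ring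
  rw [← hprod]
  simp only [pathDet, mul_pow, pow_add, hμn, hνn]
  generalize μ ^ n = x
  generalize ν ^ n = y
  field_simp
  linear_combination (x ^ 2 * (1 - μ ^ 2) - y ^ 2 * (1 - ν ^ 2)) * hρt

lemma pathDet_two_le_sq (hν : 0 < ν) (hνμ : ν < μ) (hμ : μ < 1) :
    μ ^ 2 - ν ^ 2 ≤ pathDet μ ν 2 := by
  have hd : 0 < μ ^ 2 - ν ^ 2 := by nlinarith
  rw [pathDet, le_div_iff₀ hd]
  have : 0 < ν ^ 2 * (2 - μ ^ 2) * (μ ^ 2 - ν ^ 2) :=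
    mul_pos (mul_pos (by positivity) (by nlinarith)) hd
  nlinarith

lemma sq_sub_lt_pathDet (hν : 0 < ν) (hνμ : ν < μ) (hμ : μ < 1) (n : ℕ) :
    (μ ^ (n + 1) - ν ^ (n + 1)) ^ 2 < pathDet μ ν (n + 2) := by
  have hμ0 := hν.trans hνμ
  have hd : 0 < μ ^ 2 - ν ^ 2 := by nlinarith
  have hμ1 : μ ^ 2 < 1 := by nlinarith
  rw [pathDet, lt_div_iff₀ hd]
  have hle : ν ^ n ≤ μ ^ n := pow_le_pow_left₀ hν.le hνμ.le n
  have hy : 0 < ν ^ n := by positivity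
  have hμn : (μ ^ 2) ^ n = (μ ^ n) ^ 2 := by ring
  have hνn : (ν ^ 2) ^ n = (ν ^ n) ^ 2 := by ring
  simp only [pow_add, pow_one, hμn, hνn]
  generalize μ ^ n = x at *
  generalize ν ^ n = y at *
  have h1 : 0 ≤ (1 - μ ^ 2) * (μ ^ 2 * ν ^ 2) * (x ^ 2 - y ^ 2) :=
    mul_nonneg (mul_nonneg (by linarith) (by positivity)) (by nlinarith)
  have h2 : 0 < (μ ^ 2 - ν ^ 2) * (ν * y) * (2 * (μ * x) - μ ^ 2 * (ν * y)) := by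
    refine mul_pos (mul_pos hd (by positivity)) ?_
    have : ν * y ≤ μ * x := by gcongr
    have : 0 < ν * y := by positivity
    nlinarith
  nlinarith

lemma pow_sub_sq_le (hν : 0 < ν) (hνμ : ν < μ) (n : ℕ) :
    (μ ^ 2 - ν ^ 2) ^ (n + 2) ≤ (μ ^ (n + 2) - ν ^ (n + 2)) ^ 2 := by
  have hμ0 := hν.trans hνμ
  have hd : 0 < μ ^ 2 - ν ^ 2 := by nlinarith
  induction n with
  | zero => exact le_rfl
  | succ n ih =>
    have hle : ν ^ (n + 2) ≤ μ ^ (n + 2) := pow_le_pow_left₀ hν.le hνμ.le _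
    calc (μ ^ 2 - ν ^ 2) ^ (n + 1 + 2)
        = (μ ^ 2 - ν ^ 2) * (μ ^ 2 - ν ^ 2) ^ (n + 2) := by ring
      _ ≤ μ ^ 2 * (μ ^ (n + 2) - ν ^ (n + 2)) ^ 2 := by
        gcongr
        nlinarith
      _ = (μ * (μ ^ (n + 2) - ν ^ (n + 2))) ^ 2 := by ring
      _ ≤ (μ ^ (n + 1 + 2) - ν ^ (n + 1 + 2)) ^ 2 := by
        refine pow_le_pow_left₀ (mul_nonneg hμ0.le (sub_nonneg.2 hle)) ?_ 2
        have : 0 ≤ (μ - ν) * ν ^ (n + 2) := mul_nonneg (by linarith) (by positivity)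
        linear_combination this

end Scalar


/-- **Lemma 2.1, Gaussian Wigner case with `f(x,y) = xy`, in MGF form**:
all the path and cycle MGFs are finite, the cycle MGF has the closed form
`m̃_ℓ = (λ₁^{ℓ/2} − λ₂^{ℓ/2})^{−1}` with `λ₁ > λ₂ > 0` the roots of
`x² − (1 − t²(1−ρ²))x + t²ρ² = 0`, and (i) `m₁² ≤ m̃₂ ≤ m̃₁²`; (ii) `m_ℓ < m̃_ℓ` for `ℓ ≥ 1`;
(iii) `m̃_ℓ² ≤ m̃₂^ℓ` for `ℓ ≥ 2`. -/
theorem gauss_mgf_path_cycle (ρ t : ℝ) (hρ : 0 < ρ) (hρ1 : ρ < 1)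
    (ht : 0 < t) (ht' : t < 1 / (1 + ρ)) :
    (∀ ℓ : ℕ, 1 ≤ ℓ →
      Integrable (fun ω : Fin (ℓ + 1) → ℝ × ℝ =>
          Real.exp (t * ∑ i : Fin ℓ, (ω i.castSucc).1 * (ω i.succ).2))
        (Measure.pi fun _ => gaussPair ρ) ∧
      Integrable (fun ω : Fin ℓ → ℝ × ℝ =>
          Real.exp (t * ∑ i : Fin ℓ, (ω i).1 * (ω (finRotate ℓ i)).2))
        (Measure.pi fun _ => gaussPair ρ)) ∧
    (∃ l₁ l₂ : ℝ, l₂ < l₁ ∧ 0 < l₂ ∧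
      l₁ ^ 2 - (1 - t ^ 2 * (1 - ρ ^ 2)) * l₁ + t ^ 2 * ρ ^ 2 = 0 ∧
      l₂ ^ 2 - (1 - t ^ 2 * (1 - ρ ^ 2)) * l₂ + t ^ 2 * ρ ^ 2 = 0 ∧
      ∀ ℓ : ℕ, 1 ≤ ℓ →
        gaussCycleMGF ρ t ℓ = (l₁ ^ ((ℓ : ℝ) / 2) - l₂ ^ ((ℓ : ℝ) / 2))⁻¹) ∧
    (gaussPathMGF ρ t 1) ^ 2 ≤ gaussCycleMGF ρ t 2 ∧
    gaussCycleMGF ρ t 2 ≤ (gaussCycleMGF ρ t 1) ^ 2 ∧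
    (∀ ℓ : ℕ, 1 ≤ ℓ → gaussPathMGF ρ t ℓ < gaussCycleMGF ρ t ℓ) ∧
    (∀ ℓ : ℕ, 2 ≤ ℓ → (gaussCycleMGF ρ t ℓ) ^ 2 ≤ (gaussCycleMGF ρ t 2) ^ ℓ) := by
  obtain ⟨μ, ν, hν, hνμ, hμ, hprod, hsum⟩ := exists_sqrt_roots hρ hρ1 ht ht'
  have hμ0 := hν.trans hνμ
  have hρ2 : ρ ^ 2 < 1 := by nlinarith
  have hE := isPathDet_pathDet hν hνμ hμ hprod hsum
  have hW : ∀ n : ℕ, 0 < μ ^ (n + 1) - ν ^ (n + 1) := fun n =>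
    sub_pos.2 (pow_lt_pow_left₀ hνμ hν.le n.succ_ne_zero)
  have path : ∀ n : ℕ, _ ∧ gaussPathMGF ρ t n = (Real.sqrt (pathDet μ ν (n + 1)))⁻¹ := fun n =>
    integrable_and_integral_eq_of_lintegral_eq (by fun_prop) (fun _ => (Real.exp_pos _).le)
      (by positivity) (hE.lintegral_path hρ2.le n)
  have cycle : ∀ n : ℕ, _ ∧ gaussCycleMGF ρ t (n + 1) = (μ ^ (n + 1) - ν ^ (n + 1))⁻¹ := fun n =>
    integrable_and_integral_eq_of_lintegral_eq (by fun_prop) (fun _ => (Real.exp_pos _).le)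
      (inv_nonneg.2 (hW n).le) (by
        rw [hE.lintegral_cycle hρ.ne' hρ2 n (pow_pos (hW n) 2)
          (pathDet_lincomb hν hνμ hprod hsum n), Real.sqrt_sq (hW n).le])
  have cycle_two : gaussCycleMGF ρ t 2 = (μ ^ 2 - ν ^ 2)⁻¹ := (cycle 1).2
  have hd : 0 < μ ^ 2 - ν ^ 2 := hW 1
  refine ⟨?_, ⟨μ ^ 2, ν ^ 2, sub_pos.1 hd, by positivity, ?_, ?_, ?_⟩, ?_, ?_, ?_, ?_⟩
  · rintro (_ | n) hn
    · omega
    · exact ⟨(path (n + 1)).1, (cycle n).1⟩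
  · rw [← hsum, ← mul_pow, ← hprod]; ring
  · rw [← hsum, ← mul_pow, ← hprod]; ring
  · rintro (_ | n) hn
    · omega
    · have hrpow : ∀ x : ℝ, 0 ≤ x → (x ^ 2) ^ (((n + 1 : ℕ) : ℝ) / 2) = x ^ (n + 1) := by
        intro x hx
        rw [← Real.rpow_natCast x 2, ← Real.rpow_mul hx, ← Real.rpow_natCast]
        congr 1
        push_cast
        ring
      rw [(cycle n).2, hrpow μ hμ0.le, hrpow ν hν.le]
  · rw [(path 1).2, cycle_two, inv_pow, Real.sq_sqrt (hE.pos _).le]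
    exact inv_anti₀ hd (pathDet_two_le_sq hν hνμ hμ)
  · rw [cycle_two, (cycle 0).2, inv_pow]
    refine inv_anti₀ (pow_pos (hW 0) 2) ?_
    simp only [zero_add, pow_one]
    nlinarith
  · rintro (_ | n) hn
    · omega
    · rw [(path (n + 1)).2, (cycle n).2]
      exact inv_strictAnti₀ (hW n)
        (Real.lt_sqrt_of_sq_lt (sq_sub_lt_pathDet hν hνμ hμ n))
  · rintro (_ | _ | n) hn
    · omega
    · omega
    · rw [cycle_two, (cycle (n + 1)).2, inv_pow, inv_pow]
      exact inv_anti₀ (pow_pos hd _) (pow_sub_sq_le hν hνμ n)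

end GaussMGF
end
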